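/- Let B be a separable, reflexive, uniformly smooth Banach space which is I-smoothly weakly compact for an exponent p ∈ [2,∞), let r > 0, and let f : B → B be a continuous function with at most linear growth: ‖f(x)‖ ≤ L(1+‖x‖) for all x ∈ B. Let a ∈ B and let C₀ be a nonempty ball-compact subset of B that is (r, f(·+ta) − a)-prox-regular for every t ∈ I, and define C(t) = C₀ + t a for t ∈ I. Then for every u₀ ∈ C₀, the system u̇(t) + N(C(t),u(t)) ∋ f(u(t)), u(0) = u₀, has an absolutely continuous solution u on I = [0,T] with u(t) ∈ C(t) for all t ∈ I. -/

import Mathlib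

open MeasureTheory Set Filter Topology

noncomputable section

/-- The (set-valued) metric projection onto `C`:
`P_C(y) = {z ∈ C | ‖y - z‖ = d(y,C)}`. -/
def projSet {E : Type*} [NormedAddCommGroup E] (C : Set E) (y : E) : Set E :=
  {z | z ∈ C ∧ ‖y - z‖ = Metric.infDist y C}

/-- The proximal normal cone of `C` at `x`:
`N(C,x) = {v | ∃ s > 0, x ∈ P_C(x + s v)}`. -/
def proxNormalCone {E : Type*} [NormedAddCommGroup E] [NormedSpace ℝ E]
    (C : Set E) (x : E) : Set E :=
  {v | ∃ s : ℝ, 0 < s ∧ x ∈ projSet C (x + s • v)}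

/-- `Γ^r(C,x) = {v | x ∈ P_C(x + r v)}`, the good directions to project at scale `r`. -/
def gammaSet {E : Type*} [NormedAddCommGroup E] [NormedSpace ℝ E]
    (r : ℝ) (C : Set E) (x : E) : Set E :=
  {v | x ∈ projSet C (x + r • v)}

/-- `C` is `(r,f)`-prox-regular (`r`-prox-regular in the direction `f`): for all `x ∈ C`
and `s ∈ (0,r)`, the projection `z` of `x + s f(x)/‖f(x)‖` onto `C` is well defined
(single valued), and the normalized vector from `z` to `x + s f(x)/‖f(x)‖` belongs to
`Γ^r(C,z)` (with the convention `v/‖v‖ = 0` when `v = 0`). -/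
def DirProxRegular {E : Type*} [NormedAddCommGroup E] [NormedSpace ℝ E]
    (r : ℝ) (f : E → E) (C : Set E) : Prop :=
  ∀ x ∈ C, ∀ s : ℝ, 0 < s → s < r →
    ∃ z : E, projSet C (x + (s * ‖f x‖⁻¹) • f x) = {z} ∧
      ‖x + (s * ‖f x‖⁻¹) • f x - z‖⁻¹ • (x + (s * ‖f x‖⁻¹) • f x - z) ∈ gammaSet r C z

/-- A subset is ball-compact if its intersection with every closed ball is compact. -/
def BallCompact {E : Type*} [NormedAddCommGroup E] (C : Set E) : Prop :=
  ∀ (x : E) (R : ℝ), IsCompact (C ∩ Metric.closedBall x R)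

/-- A uniformly smooth normed space: the norm is uniformly Fréchet differentiable away
from `0`, expressed through the vanishing of the modulus of smoothness. -/
def UniformlySmooth (E : Type*) [NormedAddCommGroup E] [NormedSpace ℝ E] : Prop :=
  ∀ ε > (0:ℝ), ∃ δ > (0:ℝ), ∀ x y : E, ‖x‖ = 1 → ‖y‖ ≤ δ →
    ‖x + y‖ + ‖x - y‖ - 2 ≤ ε * ‖y‖

/-- A reflexive normed space: the canonical embedding into the double dual is onto. -/
def ReflexiveSpace (E : Type*) [NormedAddCommGroup E] [NormedSpace ℝ E] : Prop :=
  Function.Surjective (NormedSpace.inclusionInDoubleDual ℝ E)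

/-- The normalized duality-type mapping `J_p(x) = (1/p) (∇‖·‖^p)(x) ∈ E*`. -/
def dualMapJ {E : Type*} [NormedAddCommGroup E] [NormedSpace ℝ E]
    (p : ℝ) (x : E) : E →L[ℝ] ℝ :=
  p⁻¹ • fderiv ℝ (fun z : E => ‖z‖ ^ p) x

/-- `E` is `I`-smoothly weakly compact for the exponent `p`: from every bounded sequence of
`L^∞(I,E)` one can extract a subsequence weakly-* converging (through the duality
`L^∞(I,E) = (L¹(I,E*))*`) to some `y ∈ L^∞(I,E)` along which the integral quantities
built from `J_p` pass to the limit. -/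
def ISmoothlyWeaklyCompact (I : Set ℝ)
    (E : Type*) [NormedAddCommGroup E] [NormedSpace ℝ E] (p : ℝ) : Prop :=
  ∀ x : ℕ → ℝ → E,
    (∀ n, AEStronglyMeasurable (x n) (volume.restrict I)) →
    (∃ M : ℝ, ∀ n, ∀ᵐ t ∂volume.restrict I, ‖x n t‖ ≤ M) →
    ∃ k : ℕ → ℕ, StrictMono k ∧ ∃ y : ℝ → E,
      AEStronglyMeasurable y (volume.restrict I) ∧
      (∃ M : ℝ, ∀ᵐ t ∂volume.restrict I, ‖y t‖ ≤ M) ∧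
      (∀ g : ℝ → (E →L[ℝ] ℝ), Integrable g (volume.restrict I) →
        Tendsto (fun n => ∫ t, g t (x (k n) t) ∂volume.restrict I) atTop
          (𝓝 (∫ t, g t (y t) ∂volume.restrict I))) ∧
      (∀ z : ℝ → E, AEStronglyMeasurable z (volume.restrict I) →
        (∃ M : ℝ, ∀ᵐ t ∂volume.restrict I, ‖z t‖ ≤ M) →
        ∀ φ : ℝ → ℝ, Integrable φ (volume.restrict I) →
          Tendsto (fun n => ∫ t,
              (dualMapJ p (z t + x (k n) t) - dualMapJ p (x (k n) t)) (x (k n) t) * φ t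
                ∂volume.restrict I) atTop
            (𝓝 (∫ t, (dualMapJ p (z t + y t) - dualMapJ p (y t)) (y t) * φ t
                ∂volume.restrict I)))

/-- An absolutely continuous solution of the sweeping process
`u̇(t) + N(C(t),u(t)) ∋ f(u(t))`, `u(0) = u₀`, on `[0,T]`: `u` is absolutely continuous,
i.e. `u(t) = u₀ + ∫₀ᵗ g` for some Bochner-integrable density `g` (`g = u̇` a.e.),
`u(t) ∈ C(t)` for all `t ∈ [0,T]` and `f(u(t)) - u̇(t) ∈ N(C(t),u(t))` a.e. on `[0,T]`. -/
def IsSweepingSol {E : Type*} [NormedAddCommGroup E] [NormedSpace ℝ E] [CompleteSpace E]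
    (C : ℝ → Set E) (f : E → E) (T : ℝ) (u₀ : E) (u : ℝ → E) : Prop :=
  ∃ g : ℝ → E, IntegrableOn g (Set.Icc 0 T) ∧
    (∀ t ∈ Set.Icc (0:ℝ) T, u t = u₀ + ∫ s in (0:ℝ)..t, g s) ∧
    (∀ t ∈ Set.Icc (0:ℝ) T, u t ∈ C t) ∧
    (∀ᵐ t ∂volume.restrict (Set.Icc (0:ℝ) T),
      f (u t) - g t ∈ proxNormalCone (C t) (u t))

lemma abs_norm_rpow_sub_norm_rpow_le {E : Type*} [NormedAddCommGroup E] {p : ℝ}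
    (hp : 1 ≤ p) {R : ℝ} {x y : E} (hx : ‖x‖ ≤ R) (hy : ‖y‖ ≤ R) :
    |‖x‖ ^ p - ‖y‖ ^ p| ≤ p * R ^ (p - 1) * ‖x - y‖ := by
  have hR : 0 ≤ R := (norm_nonneg x).trans hx
  have key := (convex_Icc (0 : ℝ) R).norm_image_sub_le_of_norm_hasDerivWithin_le
    (f := fun s : ℝ => s ^ p) (f' := fun s => p * s ^ (p - 1)) (C := p * R ^ (p - 1))
    (x := ‖y‖) (y := ‖x‖)
    (fun s _ => (Real.hasDerivAt_rpow_const (Or.inr hp)).hasDerivWithinAt)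
    (fun s hs => by
      have h0 : 0 ≤ s ^ (p - 1) := Real.rpow_nonneg hs.1 _
      rw [Real.norm_of_nonneg (by positivity)]
      have h1 : s ^ (p - 1) ≤ R ^ (p - 1) := Real.rpow_le_rpow hs.1 hs.2 (by linarith)
      gcongr)
    ⟨norm_nonneg y, hy⟩ ⟨norm_nonneg x, hx⟩
  refine key.trans ?_
  gcongr
  exact abs_norm_sub_norm_le x y

section SmoothNorm

variable {E : Type*} [NormedAddCommGroup E] [NormedSpace ℝ E]

lemma UniformlySmooth.differentiableAt_norm_of_norm_eq_one (h : UniformlySmooth E) {x : E}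
    (hx : ‖x‖ = 1) : DifferentiableAt ℝ (fun z : E => ‖z‖) x := by
  have hx0 : x ≠ 0 := by
    rintro rfl
    simp at hx
  obtain ⟨φ, hφ, hφx⟩ := exists_dual_vector ℝ x (norm_ne_zero_iff.mpr hx0)
  simp only [hx, RCLike.ofReal_real_eq_id, id_eq] at hφx
  have hle : ∀ y : E, φ y ≤ ‖y‖ := fun y =>
    (le_abs_self _).trans (by simpa [hφ] using φ.le_opNorm y)
  have hd : HasFDerivAt (fun z : E => ‖z‖) φ x := by
    rw [hasFDerivAt_iff_isLittleO_nhds_zero, Asymptotics.isLittleO_iff]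
    intro ε hε
    obtain ⟨δ, hδ, hs⟩ := h ε hε
    filter_upwards [Metric.closedBall_mem_nhds (0 : E) hδ] with y hy
    have hy' : ‖y‖ ≤ δ := by simpa using hy
    have h1 := hs x y hx hy'
    have h2 := hle (x + y)
    have h3 := hle (x - y)
    rw [map_add, hφx] at h2
    rw [map_sub, hφx] at h3
    rw [Real.norm_eq_abs, abs_le]
    have : 0 ≤ ε * ‖y‖ := by positivity
    constructor <;> linarith
  exact hd.differentiableAt

lemma UniformlySmooth.differentiableAt_norm (h : UniformlySmooth E) {x : E}
    (hx : x ≠ 0) : DifferentiableAt ℝ (fun z : E => ‖z‖) x := by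
  have hx' : ‖x‖ ≠ 0 := norm_ne_zero_iff.mpr hx
  have h1 : DifferentiableAt ℝ (fun z : E => ‖z‖) (‖x‖⁻¹ • x) :=
    h.differentiableAt_norm_of_norm_eq_one (by rw [norm_smul]; simp [hx'])
  have h2 : DifferentiableAt ℝ (fun z : E => ‖(‖x‖⁻¹ • z)‖) x :=
    h1.comp (f := fun z : E => ‖x‖⁻¹ • z) x (by fun_prop)
  have h3 := h2.const_mul ‖x‖
  have h4 : (fun z : E => ‖x‖ * ‖(‖x‖⁻¹ • z)‖) = fun z => ‖z‖ := by
    ext z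
    rw [norm_smul, norm_inv, norm_norm, mul_inv_cancel_left₀ hx']
  rwa [h4] at h3

lemma UniformlySmooth.differentiable_norm_rpow (h : UniformlySmooth E) {p : ℝ} (hp : 1 < p) :
    Differentiable ℝ (fun z : E => ‖z‖ ^ p) := by
  intro x
  by_cases hx : x = 0
  · subst hx
    have hd : HasFDerivAt (fun z : E => ‖z‖ ^ p) (0 : E →L[ℝ] ℝ) 0 := by
      rw [hasFDerivAt_iff_isLittleO_nhds_zero, Asymptotics.isLittleO_iff]
      intro ε hε
      have hlim : Tendsto (fun y : E => ‖y‖ ^ (p - 1)) (𝓝 0) (𝓝 0) := by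
        have : ContinuousAt (fun y : E => ‖y‖ ^ (p - 1)) 0 :=
          continuous_norm.continuousAt.rpow_const (Or.inr (by linarith))
        simpa [ContinuousAt, Real.zero_rpow (by linarith : p - 1 ≠ 0)] using this
      filter_upwards [hlim.eventually (ge_mem_nhds hε)] with y hy
      have hyp : ‖y‖ ^ p = ‖y‖ ^ (p - 1) * ‖y‖ := by
        rcases (norm_nonneg y).eq_or_lt with h0 | h0
        · simp [← h0, Real.zero_rpow (by linarith : p ≠ 0)]
        · rw [← Real.rpow_add_one h0.ne']
          ring_nf
      simp only [zero_add, norm_zero, Real.zero_rpow (by linarith : p ≠ 0), sub_zero,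
        zero_apply]
      rw [Real.norm_of_nonneg (by positivity), hyp]
      gcongr
    exact hd.differentiableAt
  · exact (h.differentiableAt_norm hx).rpow_const (Or.inl (norm_ne_zero_iff.mpr hx))

lemma dualMapJ_smul (p : ℝ) {c : ℝ} (hc : 0 < c) (x : E) :
    dualMapJ p (c • x) = c ^ (p - 1) • dualMapJ p x := by
  have h1 : fderiv ℝ (fun z : E => ‖c • z‖ ^ p) x =
      c • fderiv ℝ (fun z : E => ‖z‖ ^ p) (c • x) :=
    fderiv_comp_smul (f := fun z : E => ‖z‖ ^ p) c
  have h2 : (fun z : E => ‖c • z‖ ^ p) = fun z => c ^ p • ‖z‖ ^ p := by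
    ext z
    rw [norm_smul, Real.norm_of_nonneg hc.le, Real.mul_rpow hc.le (norm_nonneg z), smul_eq_mul]
  have h3 : fderiv ℝ (fun z : E => c ^ p • ‖z‖ ^ p) x =
      c ^ p • fderiv ℝ (fun z : E => ‖z‖ ^ p) x :=
    congrFun (fderiv_const_smul_field (f := fun z : E => ‖z‖ ^ p) (c ^ p)) x
  have h4 : fderiv ℝ (fun z : E => ‖z‖ ^ p) (c • x) =
      c ^ (p - 1) • fderiv ℝ (fun z : E => ‖z‖ ^ p) x := by
    rw [h2, h3] at h1
    rw [Real.rpow_sub_one hc.ne', div_eq_inv_mul, mul_smul, h1, inv_smul_smul₀ hc.ne']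
  simp only [dualMapJ, h4, smul_comm p⁻¹]

lemma UniformlySmooth.hasDerivAt_norm_rpow_line (h : UniformlySmooth E) {p : ℝ} (hp : 1 < p)
    (y z : E) (c : ℝ) :
    HasDerivAt (fun l : ℝ => ‖z + l • y‖ ^ p) (p * dualMapJ p (z + c • y) y) c := by
  have h1 := (h.differentiable_norm_rpow hp (z + c • y)).hasFDerivAt
  have h2 : HasDerivAt (fun l : ℝ => z + l • y) y c := by
    simpa using ((hasDerivAt_id c).smul_const y).const_add z
  have h3 := h1.comp_hasDerivAt c h2
  have hp0 : p ≠ 0 := by linarith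
  simpa [dualMapJ, hp0, Function.comp_def] using h3

end SmoothNorm

section IntegralFunctional

variable {E : Type*} [NormedAddCommGroup E] [NormedSpace ℝ E]

lemma UniformlySmooth.aestronglyMeasurable_dualMapJ_apply (h : UniformlySmooth E) {p : ℝ}
    (hp : 1 < p) {μ : Measure ℝ} {y z : ℝ → E} (hy : AEStronglyMeasurable y μ)
    (hz : AEStronglyMeasurable z μ) :
    AEStronglyMeasurable (fun t => dualMapJ p (z t) (y t)) μ := by
  have hc : Continuous (fun x : E => ‖x‖ ^ p) := (h.differentiable_norm_rpow hp).continuous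
  have hlim : Tendsto (fun n : ℕ => ((n : ℝ) + 1)⁻¹) atTop (𝓝[≠] (0 : ℝ)) := by
    refine tendsto_nhdsWithin_iff.mpr ⟨?_, Eventually.of_forall fun n => ?_⟩
    · simpa using tendsto_one_div_add_atTop_nhds_zero_nat (𝕜 := ℝ)
    · have : (0 : ℝ) < (n : ℝ) + 1 := by positivity
      simpa using this.ne'
  refine aestronglyMeasurable_of_tendsto_ae atTop
    (f := fun (n : ℕ) t => p⁻¹ * ((((n : ℝ) + 1)⁻¹)⁻¹ *
      (‖z t + ((n : ℝ) + 1)⁻¹ • y t‖ ^ p - ‖z t‖ ^ p))) (fun n => ?_)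
    (Eventually.of_forall fun t => ?_)
  · have h1 := hc.comp_aestronglyMeasurable (hz.add (hy.const_smul ((n : ℝ) + 1)⁻¹))
    have h2 := hc.comp_aestronglyMeasurable hz
    exact ((h1.sub h2).const_mul _).const_mul _
  · have hd := h.hasDerivAt_norm_rpow_line hp (y t) (z t) 0
    rw [hasDerivAt_iff_tendsto_slope_zero] at hd
    have h3 := (hd.comp hlim).const_mul p⁻¹
    have hp0 : p ≠ 0 := by linarith
    simpa [Function.comp_def, hp0] using h3

/-- The functional `∫ (‖z + l y‖ ^ p - ‖l y‖ ^ p) ψ`, which interpolates between a quantity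
that does not depend on `y` at `l = 0` and the one of interest at `l = 1`. -/
def rpowGap (μ : Measure ℝ) (p : ℝ) (ψ : ℝ → ℝ) (y z : ℝ → E) (l : ℝ) : ℝ :=
  ∫ t, (‖z t + l • y t‖ ^ p - ‖l • y t‖ ^ p) * ψ t ∂μ

lemma abs_rpow_gap_sub_le {p : ℝ} (hp : 1 ≤ p) {M Z b : ℝ} {y z : E} (hy : ‖y‖ ≤ M)
    (hz : ‖z‖ ≤ Z) (hb : |b| ≤ 1) {l m : ℝ} (hl : |l| ≤ 2) (hm : |m| ≤ 2) :
    |(‖z + l • y‖ ^ p - ‖l • y‖ ^ p) * b - (‖z + m • y‖ ^ p - ‖m • y‖ ^ p) * b| ≤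
      2 * (p * (Z + 2 * M) ^ (p - 1) * M) * |l - m| := by
  have hM : 0 ≤ M := (norm_nonneg y).trans hy
  have hZ : 0 ≤ Z := (norm_nonneg z).trans hz
  have hs : ∀ k : ℝ, |k| ≤ 2 → ‖k • y‖ ≤ 2 * M := fun k hk => by
    rw [norm_smul, Real.norm_eq_abs]
    gcongr
  have h1 := abs_norm_rpow_sub_norm_rpow_le hp (R := Z + 2 * M) (x := z + l • y)
    (y := z + m • y) ((norm_add_le _ _).trans (add_le_add hz (hs l hl)))
    ((norm_add_le _ _).trans (add_le_add hz (hs m hm)))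
  have h2 := abs_norm_rpow_sub_norm_rpow_le hp (R := Z + 2 * M) (x := l • y)
    (y := m • y) ((hs l hl).trans (by linarith)) ((hs m hm).trans (by linarith))
  have h3 : ‖l • y - m • y‖ ≤ |l - m| * M := by
    rw [← sub_smul, norm_smul, Real.norm_eq_abs]
    gcongr
  rw [add_sub_add_left_eq_sub] at h1
  have hK : 0 ≤ p * (Z + 2 * M) ^ (p - 1) := by positivity
  have h4 := mul_le_mul_of_nonneg_left h3 hK
  rw [← sub_mul, abs_mul]
  calc _ ≤ |(‖z + l • y‖ ^ p - ‖l • y‖ ^ p) - (‖z + m • y‖ ^ p - ‖m • y‖ ^ p)| * 1 := by gcongr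
    _ = |(‖z + l • y‖ ^ p - ‖z + m • y‖ ^ p) - (‖l • y‖ ^ p - ‖m • y‖ ^ p)| := by
      rw [mul_one]
      congr 1
      ring
    _ ≤ _ := (abs_sub _ _).trans (by linarith)

variable {μ : Measure ℝ} {p M Z : ℝ} {ψ : ℝ → ℝ} {y z : ℝ → E}

lemma aestronglyMeasurable_rpow_gap (hp : 0 ≤ p) (hy : AEStronglyMeasurable y μ)
    (hz : AEStronglyMeasurable z μ) (hψ : AEStronglyMeasurable ψ μ) (l : ℝ) :
    AEStronglyMeasurable (fun t => (‖z t + l • y t‖ ^ p - ‖l • y t‖ ^ p) * ψ t) μ := by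
  have hc : Continuous (fun x : E => ‖x‖ ^ p) :=
    continuous_norm.rpow_const fun _ => Or.inr hp
  exact ((hc.comp_aestronglyMeasurable (hz.add (hy.const_smul l))).sub
    (hc.comp_aestronglyMeasurable (hy.const_smul l))).mul hψ

variable [IsFiniteMeasure μ]

lemma integrable_rpow_gap (hp : 1 ≤ p) (hy : AEStronglyMeasurable y μ)
    (hz : AEStronglyMeasurable z μ) (hψ : AEStronglyMeasurable ψ μ)
    (hyM : ∀ᵐ t ∂μ, ‖y t‖ ≤ M) (hzZ : ∀ᵐ t ∂μ, ‖z t‖ ≤ Z) (hψ1 : ∀ t, |ψ t| ≤ 1)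
    {l : ℝ} (hl : |l| ≤ 2) :
    Integrable (fun t => (‖z t + l • y t‖ ^ p - ‖l • y t‖ ^ p) * ψ t) μ := by
  refine Integrable.of_bound (aestronglyMeasurable_rpow_gap (by linarith) hy hz hψ l)
    (p * (Z + 2 * M) ^ (p - 1) * Z) ?_
  filter_upwards [hyM, hzZ] with t h1 h2
  have hM : 0 ≤ M := (norm_nonneg _).trans h1
  have hZ : 0 ≤ Z := (norm_nonneg _).trans h2
  have h3 : ‖l • y t‖ ≤ 2 * M := by
    rw [norm_smul, Real.norm_eq_abs]
    gcongr
  have h4 := abs_norm_rpow_sub_norm_rpow_le hp (R := Z + 2 * M) (x := z t + l • y t)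
    (y := l • y t) ((norm_add_le _ _).trans (add_le_add h2 h3)) (h3.trans (by linarith))
  rw [add_sub_cancel_right] at h4
  rw [norm_mul, Real.norm_eq_abs, Real.norm_eq_abs]
  calc _ ≤ |‖z t + l • y t‖ ^ p - ‖l • y t‖ ^ p| * 1 := by gcongr; exact hψ1 t
    _ ≤ _ := by
      rw [mul_one]
      exact h4.trans (by gcongr)

lemma UniformlySmooth.hasDerivAt_rpowGap (h : UniformlySmooth E) (hp : 1 < p)
    (hy : AEStronglyMeasurable y μ) (hz : AEStronglyMeasurable z μ)
    (hψ : AEStronglyMeasurable ψ μ) (hyM : ∀ᵐ t ∂μ, ‖y t‖ ≤ M) (hzZ : ∀ᵐ t ∂μ, ‖z t‖ ≤ Z)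
    (hψ1 : ∀ t, |ψ t| ≤ 1) {l : ℝ} (hl : |l| ≤ 1) :
    HasDerivAt (rpowGap μ p ψ y z)
      (∫ t, p * (dualMapJ p (z t + l • y t) - dualMapJ p (l • y t)) (y t) * ψ t ∂μ) l := by
  have hb : ∀ m ∈ Metric.ball l 1, |m| ≤ 2 := fun m hm => by
    rw [Metric.mem_ball, Real.dist_eq] at hm
    have := abs_add_le (m - l) l
    rw [sub_add_cancel] at this
    linarith
  refine (hasDerivAt_integral_of_dominated_loc_of_lip (μ := μ)
    (F := fun l t => (‖z t + l • y t‖ ^ p - ‖l • y t‖ ^ p) * ψ t) (x₀ := l)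
    (s := Metric.ball l 1)
    (bound := fun _ => 2 * (p * (Z + 2 * M) ^ (p - 1) * M)) (Metric.ball_mem_nhds l one_pos)
    (Eventually.of_forall fun m => aestronglyMeasurable_rpow_gap (by linarith) hy hz hψ m)
    (integrable_rpow_gap hp.le hy hz hψ hyM hzZ hψ1 (by linarith)) ?_ ?_
    (integrable_const _) ?_).2
  · have h1 := h.aestronglyMeasurable_dualMapJ_apply hp hy (hz.add (hy.const_smul l))
    have h2 := h.aestronglyMeasurable_dualMapJ_apply hp hy (hy.const_smul l)
    exact ((h1.sub h2).const_mul p).mul hψ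
  · filter_upwards [hyM, hzZ] with t h1 h2
    refine LipschitzOnWith.of_dist_le_mul fun m hm k hk => ?_
    rw [Real.dist_eq, Real.dist_eq]
    refine (abs_rpow_gap_sub_le hp.le h1 h2 (hψ1 t) (hb m hm) (hb k hk)).trans ?_
    rw [Real.coe_nnabs]
    gcongr
    exact le_abs_self _
  · refine Eventually.of_forall fun t => ?_
    have h1 := h.hasDerivAt_norm_rpow_line hp (y t) (z t) l
    have h2 := h.hasDerivAt_norm_rpow_line hp (y t) 0 l
    simp only [zero_add] at h2
    have h3 := (h1.sub h2).mul_const (ψ t)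
    rw [← mul_sub] at h3
    exact h3

lemma abs_rpowGap_sub_le (hp : 1 ≤ p)
    (hy : AEStronglyMeasurable y μ) (hz : AEStronglyMeasurable z μ)
    (hψ : AEStronglyMeasurable ψ μ) (hyM : ∀ᵐ t ∂μ, ‖y t‖ ≤ M) (hzZ : ∀ᵐ t ∂μ, ‖z t‖ ≤ Z)
    (hψ1 : ∀ t, |ψ t| ≤ 1) {l m : ℝ} (hl : |l| ≤ 2) (hm : |m| ≤ 2) :
    |rpowGap μ p ψ y z l - rpowGap μ p ψ y z m| ≤
      2 * (p * (Z + 2 * M) ^ (p - 1) * M) * μ.real univ * |l - m| := by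
  rw [rpowGap, rpowGap, ← integral_sub (integrable_rpow_gap hp hy hz hψ hyM hzZ hψ1 hl)
    (integrable_rpow_gap hp hy hz hψ hyM hzZ hψ1 hm), ← Real.norm_eq_abs]
  refine (norm_integral_le_of_norm_le_const (C := 2 * (p * (Z + 2 * M) ^ (p - 1) * M) * |l - m|)
    ?_).trans (le_of_eq (by ring))
  filter_upwards [hyM, hzZ] with t h1 h2
  exact abs_rpow_gap_sub_le hp h1 h2 (hψ1 t) hl hm

/-- Convergence of derivatives propagates to the values. -/
lemma tendsto_of_tendsto_deriv {W : ℕ → ℝ → ℝ} {V : ℝ → ℝ} {W' : ℕ → ℝ → ℝ} {V' : ℝ → ℝ} {K : ℝ}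
    (hW : ∀ n, ∀ l ∈ Icc (0 : ℝ) 1, HasDerivAt (W n) (W' n l) l)
    (hV : ∀ l ∈ Icc (0 : ℝ) 1, HasDerivAt V (V' l) l)
    (hK : ∀ n, ∀ l ∈ Icc (0 : ℝ) 1, |W' n l| ≤ K) (hKV : ∀ l ∈ Icc (0 : ℝ) 1, |V' l| ≤ K)
    (h0 : ∀ n, W n 0 = V 0)
    (hlim : ∀ l ∈ Ioc (0 : ℝ) 1, Tendsto (fun n => W' n l) atTop (𝓝 (V' l))) :
    Tendsto (fun n => W n 1) atTop (𝓝 (V 1)) := by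
  have hftc : ∀ (U U' : ℝ → ℝ), (∀ l ∈ Icc (0 : ℝ) 1, HasDerivAt U (U' l) l) →
      (∀ l ∈ Icc (0 : ℝ) 1, |U' l| ≤ K) →
      (∫ l in (0 : ℝ)..1, deriv U l) = U 1 - U 0 := fun U U' hU hb => by
    refine intervalIntegral.integral_deriv_eq_sub (fun l hl => ?_) ?_
    · rw [uIcc_of_le zero_le_one] at hl
      exact (hU l hl).differentiableAt
    · rw [intervalIntegrable_iff_integrableOn_Ioc_of_le zero_le_one]
      refine Measure.integrableOn_of_bounded (M := K) (by simp)
        (measurable_deriv U).aestronglyMeasurable ?_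
      filter_upwards [ae_restrict_mem measurableSet_Ioc] with l hl
      rw [(hU l (Ioc_subset_Icc_self hl)).deriv]
      exact hb l (Ioc_subset_Icc_self hl)
  have hconv : Tendsto (fun n => ∫ l in (0 : ℝ)..1, deriv (W n) l) atTop
      (𝓝 (∫ l in (0 : ℝ)..1, deriv V l)) := by
    refine intervalIntegral.tendsto_integral_filter_of_dominated_convergence (fun _ => K)
      (Eventually.of_forall fun n => (measurable_deriv _).aestronglyMeasurable)
      (Eventually.of_forall fun n => Eventually.of_forall fun l hl => ?_)
      intervalIntegrable_const (Eventually.of_forall fun l hl => ?_)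
    · rw [uIoc_of_le zero_le_one] at hl
      rw [(hW n l (Ioc_subset_Icc_self hl)).deriv]
      exact hK n l (Ioc_subset_Icc_self hl)
    · rw [uIoc_of_le zero_le_one] at hl
      simp only [(hW _ l (Ioc_subset_Icc_self hl)).deriv, (hV l (Ioc_subset_Icc_self hl)).deriv]
      exact hlim l hl
  rw [hftc V V' hV hKV] at hconv
  have h1 := hconv.add_const (V 0)
  simp only [fun n => hftc (W n) (W' n) (hW n) (hK n), h0, sub_add_cancel] at h1
  exact h1

lemma UniformlySmooth.tendsto_rpowGap_one (h : UniformlySmooth E) (hp : 1 < p)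
    {Y : ℕ → ℝ → E} (hY : ∀ n, AEStronglyMeasurable (Y n) μ)
    (hYM : ∀ n, ∀ᵐ t ∂μ, ‖Y n t‖ ≤ M)
    (hy : AEStronglyMeasurable y μ) (hz : AEStronglyMeasurable z μ)
    (hψ : AEStronglyMeasurable ψ μ) (hyM : ∀ᵐ t ∂μ, ‖y t‖ ≤ M) (hzZ : ∀ᵐ t ∂μ, ‖z t‖ ≤ Z)
    (hψ1 : ∀ t, |ψ t| ≤ 1)
    (hlim : ∀ c : ℝ, Tendsto
      (fun n => ∫ t, (dualMapJ p (c • z t + Y n t) - dualMapJ p (Y n t)) (Y n t) * ψ t ∂μ) atTop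
      (𝓝 (∫ t, (dualMapJ p (c • z t + y t) - dualMapJ p (y t)) (y t) * ψ t ∂μ))) :
    Tendsto (fun n => rpowGap μ p ψ (Y n) z 1) atTop (𝓝 (rpowGap μ p ψ y z 1)) := by
  have habs : ∀ l ∈ Icc (0 : ℝ) 1, |l| ≤ 1 := fun l hl => by rw [abs_of_nonneg hl.1]; exact hl.2
  have hbound : ∀ (x : ℝ → E), AEStronglyMeasurable x μ → (∀ᵐ t ∂μ, ‖x t‖ ≤ M) →
      ∀ l ∈ Icc (0 : ℝ) 1,
      |∫ t, p * (dualMapJ p (z t + l • x t) - dualMapJ p (l • x t)) (x t) * ψ t ∂μ| ≤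
        |2 * (p * (Z + 2 * M) ^ (p - 1) * M) * μ.real univ| := fun x hx hxM l hl => by
    rw [← Real.norm_eq_abs]
    refine (h.hasDerivAt_rpowGap hp hx hz hψ hxM hzZ hψ1 (habs l hl)).le_of_lip'
      (abs_nonneg _) ?_
    filter_upwards [Metric.ball_mem_nhds l one_pos] with m hm
    rw [Metric.mem_ball, Real.dist_eq] at hm
    have h1 := abs_add_le (m - l) l
    rw [sub_add_cancel] at h1
    have h2 := habs l hl
    refine (abs_rpowGap_sub_le hp.le hx hz hψ hxM hzZ hψ1 (by linarith) (by linarith)).trans ?_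
    rw [Real.norm_eq_abs]
    gcongr
    exact le_abs_self _
  have hscale : ∀ (x : ℝ → E), ∀ l ∈ Ioc (0 : ℝ) 1,
      ∫ t, p * (dualMapJ p (z t + l • x t) - dualMapJ p (l • x t)) (x t) * ψ t ∂μ =
        p * l ^ (p - 1) *
          ∫ t, (dualMapJ p (l⁻¹ • z t + x t) - dualMapJ p (x t)) (x t) * ψ t ∂μ := fun x l hl => by
    rw [← integral_const_mul]
    refine integral_congr_ae (Eventually.of_forall fun t => ?_)
    have h1 : z t + l • x t = l • (l⁻¹ • z t + x t) := by
      rw [smul_add, smul_inv_smul₀ hl.1.ne']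
    simp only [h1, dualMapJ_smul p hl.1, sub_apply, smul_apply, smul_eq_mul]
    ring
  refine tendsto_of_tendsto_deriv
    (fun n l hl => h.hasDerivAt_rpowGap hp (hY n) hz hψ (hYM n) hzZ hψ1 (habs l hl))
    (fun l hl => h.hasDerivAt_rpowGap hp hy hz hψ hyM hzZ hψ1 (habs l hl))
    (fun n l hl => hbound _ (hY n) (hYM n) l hl) (fun l hl => hbound _ hy hyM l hl)
    (fun n => by simp [rpowGap]) (fun l hl => ?_)
  simp only [hscale _ l hl]
  exact (hlim l⁻¹).const_mul _

end IntegralFunctional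

section Discretization

lemma stronglyMeasurable_comp_floor_div {E : Type*} [NormedAddCommGroup E] (G : ℕ → E)
    (h : ℝ) :
    StronglyMeasurable fun t : ℝ => G ⌊t / h⌋₊ :=
  (StronglyMeasurable.of_discrete (f := G)).comp_measurable
    (Nat.measurable_floor.comp (measurable_id.div_const h))

lemma intervalIntegrable_comp_floor_div {E : Type*} [NormedAddCommGroup E] (G : ℕ → E)
    {h : ℝ} (hh : 0 < h) {a b : ℝ} :
    IntervalIntegrable (fun s : ℝ => G ⌊s / h⌋₊) volume a b := by
  rw [intervalIntegrable_iff]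
  refine Measure.integrableOn_of_bounded
    (M := ∑ i ∈ Finset.range (⌊max a b / h⌋₊ + 1), ‖G i‖) (by simp [uIoc])
    (stronglyMeasurable_comp_floor_div G h).aestronglyMeasurable ?_
  filter_upwards [ae_restrict_mem measurableSet_uIoc] with s hs
  refine Finset.single_le_sum (f := fun i => ‖G i‖) (fun i _ => norm_nonneg _) ?_
  rw [Finset.mem_range, Nat.lt_succ_iff]
  exact Nat.floor_le_floor (div_le_div_of_nonneg_right hs.2 hh.le)

variable {E : Type*} [NormedAddCommGroup E] [NormedSpace ℝ E]

lemma norm_le_norm_sub_add_of_mem_gammaSet {r : ℝ} {C : Set E} {z w : E}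
    (h : ‖w‖⁻¹ • w ∈ gammaSet r C z) {s : ℝ} (hs : 0 ≤ s) (hsr : s * ‖w‖ ≤ r) {c : E}
    (hc : c ∈ C) : ‖s • w‖ ≤ ‖z - c + s • w‖ := by
  rcases eq_or_ne w 0 with rfl | hw
  · simp
  have hw' : 0 < ‖w‖ := norm_pos_iff.mpr hw
  have h1 := h.2.trans_le (Metric.infDist_le_dist_of_mem hc)
  rw [dist_eq_norm, add_sub_cancel_left] at h1
  have h2 : ‖r • ‖w‖⁻¹ • w‖ = r := by
    rw [norm_smul, norm_smul, norm_inv, norm_norm, inv_mul_cancel₀ hw'.ne', mul_one,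
      Real.norm_of_nonneg ((by positivity : 0 ≤ s * ‖w‖).trans hsr)]
  have h3 : z + r • ‖w‖⁻¹ • w - c = (z - c + s • w) + (r * ‖w‖⁻¹ - s) • w := by
    rw [sub_smul, mul_smul]
    abel
  have h4 : ‖(r * ‖w‖⁻¹ - s) • w‖ = r - s * ‖w‖ := by
    have : 0 ≤ r * ‖w‖⁻¹ - s := by
      rw [sub_nonneg, ← div_eq_mul_inv, le_div_iff₀ hw']
      exact hsr
    rw [norm_smul, Real.norm_of_nonneg this, sub_mul, inv_mul_cancel_right₀ hw'.ne']
  rw [h2, h3] at h1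
  have h5 := h1.trans (norm_add_le _ _)
  rw [h4] at h5
  rw [norm_smul, Real.norm_of_nonneg hs]
  linarith

lemma DirProxRegular.exists_step {r : ℝ} {g : E → E} {C : Set E} (hC : DirProxRegular r g C)
    {x : E} (hx : x ∈ C) {h : ℝ} (hh : 0 < h) (hlt : h * ‖g x‖ < r) :
    ∃ z ∈ C, ‖x + h • g x - z‖ ≤ h * ‖g x‖ ∧
      ∀ s : ℝ, 0 ≤ s → s * ‖x + h • g x - z‖ ≤ r → ∀ c ∈ C,
        ‖s • (x + h • g x - z)‖ ≤ ‖z - c + s • (x + h • g x - z)‖ := by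
  by_cases hg : g x = 0
  · exact ⟨x, hx, by simp [hg], fun s _ _ c _ => by simp [hg]⟩
  have hg' : 0 < ‖g x‖ := norm_pos_iff.mpr hg
  obtain ⟨z, hz, hzΓ⟩ := hC x hx (h * ‖g x‖) (by positivity) hlt
  rw [mul_inv_cancel_right₀ hg'.ne'] at hz hzΓ
  have hz' : z ∈ projSet C (x + h • g x) := hz ▸ mem_singleton z
  refine ⟨z, hz'.1, ?_, fun s hs hsr c hc =>
    norm_le_norm_sub_add_of_mem_gammaSet hzΓ hs hsr hc⟩
  rw [hz'.2]
  refine (Metric.infDist_le_dist_of_mem hx).trans ?_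
  rw [dist_eq_norm, add_sub_cancel_left, norm_smul, Real.norm_of_nonneg hh.le]

/-- The catching-up algorithm with time step `h`. -/
lemma exists_catching_up_seq {C : Set E} {F : ℝ → E → E} {T K r M h : ℝ} {u₀ : E}
    (hprox : ∀ t ∈ Icc 0 T, DirProxRegular r (F t) C) (hK : 0 ≤ K)
    (hF : ∀ t ∈ Icc 0 T, ∀ x, ‖F t x‖ ≤ K * (1 + ‖x‖)) (hu₀ : u₀ ∈ C)
    (hM : K * (Real.exp (2 * K * T) * (1 + ‖u₀‖)) ≤ M) (hh : 0 < h) (hhM : h * M < r) :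
    ∃ x : ℕ → E, x 0 = u₀ ∧ ∀ i : ℕ, i * h ≤ T →
      x i ∈ C ∧ 1 + ‖x i‖ ≤ Real.exp (2 * K * T) * (1 + ‖u₀‖) ∧
      ‖F (i * h) (x i)‖ ≤ M ∧ ‖x i + h • F (i * h) (x i) - x (i + 1)‖ ≤ h * M ∧
      ∀ s : ℝ, 0 ≤ s → s * (h * M) ≤ r → ∀ c ∈ C,
        ‖s • (x i + h • F (i * h) (x i) - x (i + 1))‖ ≤
          ‖x (i + 1) - c + s • (x i + h • F (i * h) (x i) - x (i + 1))‖ := by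
  have hstep : ∀ t x, ∃ z, t ∈ Icc 0 T → x ∈ C → h * ‖F t x‖ < r →
      z ∈ C ∧ ‖x + h • F t x - z‖ ≤ h * ‖F t x‖ ∧
      ∀ s : ℝ, 0 ≤ s → s * ‖x + h • F t x - z‖ ≤ r → ∀ c ∈ C,
        ‖s • (x + h • F t x - z)‖ ≤ ‖z - c + s • (x + h • F t x - z)‖ := fun t x => by
    by_cases hcase : t ∈ Icc 0 T ∧ x ∈ C ∧ h * ‖F t x‖ < r
    · obtain ⟨z, hz⟩ := (hprox t hcase.1).exists_step hcase.2.1 hh hcase.2.2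
      exact ⟨z, fun _ _ _ => hz⟩
    · exact ⟨0, fun h1 h2 h3 => (hcase ⟨h1, h2, h3⟩).elim⟩
  choose S hS using hstep
  let x : ℕ → E := fun i => Nat.rec u₀ (fun j y => S (j * h) y) i
  have hx : ∀ i, x (i + 1) = S (i * h) (x i) := fun i => rfl
  have hFM : ∀ t ∈ Icc 0 T, ∀ y, 1 + ‖y‖ ≤ Real.exp (2 * K * T) * (1 + ‖u₀‖) → ‖F t y‖ ≤ M :=
    fun t ht y hy => (hF t ht y).trans ((mul_le_mul_of_nonneg_left hy hK).trans hM)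
  have hexp : ∀ i : ℕ, i * h ≤ T → Real.exp (2 * K * (i * h)) * (1 + ‖u₀‖) ≤
      Real.exp (2 * K * T) * (1 + ‖u₀‖) := fun i hi => by gcongr
  have hmem : ∀ i : ℕ, (i : ℝ) * h ≤ T → (i : ℝ) * h ∈ Icc 0 T := fun i hi => ⟨by positivity, hi⟩
  have hinv : ∀ i : ℕ, i * h ≤ T →
      x i ∈ C ∧ 1 + ‖x i‖ ≤ Real.exp (2 * K * (i * h)) * (1 + ‖u₀‖) := fun i => by
    induction i with
    | zero => exact fun _ => ⟨hu₀, by simp [x]⟩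
    | succ i ih =>
      intro hi
      push_cast at hi ⊢
      have hi' : i * h ≤ T := by linarith
      obtain ⟨hxC, hxb⟩ := ih hi'
      have hFi := hFM _ (hmem i hi') (x i) (hxb.trans (hexp i hi'))
      obtain ⟨h1, h2, -⟩ := hS (i * h) (x i) (hmem i hi') hxC
        ((mul_le_mul_of_nonneg_left hFi hh.le).trans_lt hhM)
      rw [← hx] at h1 h2
      refine ⟨h1, ?_⟩
      have h3 : ‖x (i + 1)‖ ≤ ‖x i‖ + h * ‖F (i * h) (x i)‖ + h * ‖F (i * h) (x i)‖ := by
        calc ‖x (i + 1)‖ = ‖x i + h • F (i * h) (x i) -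
              (x i + h • F (i * h) (x i) - x (i + 1))‖ := by rw [sub_sub_cancel]
          _ ≤ _ := (norm_sub_le _ _).trans (add_le_add ((norm_add_le _ _).trans
              (by rw [norm_smul, Real.norm_of_nonneg hh.le])) h2)
      have h4 := mul_le_mul_of_nonneg_left (hF _ (hmem i hi') (x i)) hh.le
      have h5 := Real.add_one_le_exp (2 * K * h)
      have h6 : Real.exp (2 * K * ((i + 1) * h)) =
          Real.exp (2 * K * h) * Real.exp (2 * K * (i * h)) := by
        rw [← Real.exp_add]
        congr 1
        ring
      calc 1 + ‖x (i + 1)‖ ≤ (2 * K * h + 1) * (1 + ‖x i‖) := by linarith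
        _ ≤ Real.exp (2 * K * h) * (Real.exp (2 * K * (i * h)) * (1 + ‖u₀‖)) := by gcongr
        _ = _ := by rw [← mul_assoc, ← h6]
  refine ⟨x, rfl, fun i hi => ?_⟩
  obtain ⟨hxC, hxb⟩ := hinv i hi
  have hxb' := hxb.trans (hexp i hi)
  have hFi := hFM _ (hmem i hi) (x i) hxb'
  have hFi' := mul_le_mul_of_nonneg_left hFi hh.le
  obtain ⟨-, h2, h3⟩ := hS (i * h) (x i) (hmem i hi) hxC (hFi'.trans_lt hhM)
  rw [← hx] at h2 h3
  exact ⟨hxC, hxb', hFi, h2.trans hFi', fun s hs hsr =>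
    h3 s hs ((mul_le_mul_of_nonneg_left (h2.trans hFi') hs).trans hsr)⟩

lemma norm_integral_comp_floor_div_sub_sum_le [CompleteSpace E] (G : ℕ → E) {h t A : ℝ} (hh : 0 < h) (ht : 0 ≤ t)
    (hA : ‖G ⌊t / h⌋₊‖ ≤ A) :
    ‖(∫ s in (0 : ℝ)..t, G ⌊s / h⌋₊) - ∑ i ∈ Finset.range ⌊t / h⌋₊, h • G i‖ ≤ A * h := by
  have hA0 : 0 ≤ A := (norm_nonneg _).trans hA
  have hII := fun a b => intervalIntegrable_comp_floor_div G hh (a := a) (b := b)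
  have hcell : ∀ (i : ℕ) (s : ℝ), i * h ≤ s → s < (i + 1) * h → ⌊s / h⌋₊ = i := fun i s h1 h2 => by
    rw [Nat.floor_eq_iff (div_nonneg ((by positivity : (0 : ℝ) ≤ i * h).trans h1) hh.le),
      le_div_iff₀ hh, div_lt_iff₀ hh]
    exact ⟨h1, h2⟩
  have hsum : ∀ n : ℕ, ∫ s in (0 : ℝ)..(n * h), G ⌊s / h⌋₊ = ∑ i ∈ Finset.range n, h • G i := by
    intro n
    induction n with
    | zero => simp
    | succ n ih =>
      rw [← intervalIntegral.integral_add_adjacent_intervals (hII 0 (n * h)) (hII _ _), ih,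
        Finset.sum_range_succ]
      congr 1
      have hle : n * h ≤ ((n + 1 : ℕ) : ℝ) * h := by
        push_cast
        linarith
      have h1 : ∫ s in (n * h)..(((n + 1 : ℕ) : ℝ) * h), G ⌊s / h⌋₊ =
          ∫ s in (n * h)..(((n + 1 : ℕ) : ℝ) * h), G n := by
        refine intervalIntegral.integral_congr_Ioo_of_le hle fun s hs => ?_
        rw [hcell n s hs.1.le (by simpa using hs.2)]
      rw [h1, intervalIntegral.integral_const]
      congr 1
      push_cast
      ring
  have hN1 : ⌊t / h⌋₊ * h ≤ t := by
    rw [← le_div_iff₀ hh]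
    exact Nat.floor_le (by positivity)
  have hN2 : t < (⌊t / h⌋₊ + 1) * h := by
    rw [← div_lt_iff₀ hh]
    exact Nat.lt_floor_add_one _
  rw [← hsum, intervalIntegral.integral_interval_sub_left (hII _ _) (hII _ _)]
  refine (intervalIntegral.norm_integral_le_of_norm_le_const (C := A) fun s hs => ?_).trans ?_
  · rw [uIoc_of_le hN1] at hs
    rw [hcell _ s hs.1.le (hs.2.trans_lt hN2)]
    exact hA
  · rw [abs_of_nonneg (by linarith)]
    gcongr
    linarith

end Discretization

/-- The step functions built from the catching-up algorithm with time step `h`: the position `X`,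
the perturbation `Φ` and the selection `ξ` of the normal cone. -/
lemma exists_catching_up_fun {E : Type*} [NormedAddCommGroup E] [NormedSpace ℝ E]
    [CompleteSpace E] {C : Set E} {F : ℝ → E → E} {T K r M h : ℝ} {u₀ : E}
    (hprox : ∀ t ∈ Icc 0 T, DirProxRegular r (F t) C) (hK : 0 ≤ K)
    (hF : ∀ t ∈ Icc 0 T, ∀ x, ‖F t x‖ ≤ K * (1 + ‖x‖)) (hu₀ : u₀ ∈ C)
    (hM : K * (Real.exp (2 * K * T) * (1 + ‖u₀‖)) ≤ M) (hh : 0 < h) (hhM : h * M < r) :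
    ∃ (θ : ℝ → ℝ) (X Φ ξ : ℝ → E),
      StronglyMeasurable X ∧ StronglyMeasurable Φ ∧ StronglyMeasurable ξ ∧
      ∀ t ∈ Icc 0 T, |θ t - t| ≤ h ∧ X t ∈ C ∧
        ‖X t‖ ≤ Real.exp (2 * K * T) * (1 + ‖u₀‖) ∧ Φ t = F (θ t) (X t) ∧
        ‖Φ t‖ ≤ M ∧ ‖ξ t‖ ≤ M ∧
        ‖u₀ + (∫ s in (0 : ℝ)..t, (Φ s - ξ s)) - X t‖ ≤ 2 * M * h ∧
        ∀ s : ℝ, 0 ≤ s → s * M ≤ r → ∀ c ∈ C,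
          ‖s • ξ t‖ ≤ ‖X t + h • (Φ t - ξ t) - c + s • ξ t‖ := by
  obtain ⟨x, hx0, hx⟩ := exists_catching_up_seq hprox hK hF hu₀ hM hh hhM
  set w : ℕ → E := fun i => x i + h • F (i * h) (x i) - x (i + 1) with hw
  have hnext : ∀ i : ℕ, x i + h • (F (i * h) (x i) - h⁻¹ • w i) = x (i + 1) := fun i => by
    rw [smul_sub, smul_inv_smul₀ hh.ne']
    simp only [hw]
    abel
  have hdiff : ∀ i : ℕ, h • (F (i * h) (x i) - h⁻¹ • w i) = x (i + 1) - x i := fun i => by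
    rw [← hnext i, add_sub_cancel_left]
  have hξM : ∀ i : ℕ, i * h ≤ T → ‖h⁻¹ • w i‖ ≤ M := fun i hi => by
    rw [norm_smul, norm_inv, Real.norm_of_nonneg hh.le, inv_mul_le_iff₀ hh]
    exact (hx i hi).2.2.2.1
  refine ⟨fun t => ⌊t / h⌋₊ * h, fun t => x ⌊t / h⌋₊, fun t => F (⌊t / h⌋₊ * h) (x ⌊t / h⌋₊),
    fun t => h⁻¹ • w ⌊t / h⌋₊, stronglyMeasurable_comp_floor_div x h,
    stronglyMeasurable_comp_floor_div (fun i => F (i * h) (x i)) h,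
    stronglyMeasurable_comp_floor_div (fun i => h⁻¹ • w i) h, fun t ht => ?_⟩
  have hN1 : ⌊t / h⌋₊ * h ≤ t := by
    rw [← le_div_iff₀ hh]
    exact Nat.floor_le (div_nonneg ht.1 hh.le)
  have hN2 : t < (⌊t / h⌋₊ + 1) * h := by
    rw [← div_lt_iff₀ hh]
    exact Nat.lt_floor_add_one _
  have hi : ⌊t / h⌋₊ * h ≤ T := hN1.trans ht.2
  obtain ⟨h1, h2, h3, -, h4⟩ := hx _ hi
  refine ⟨?_, h1, by linarith, rfl, h3, hξM _ hi, ?_, ?_⟩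
  · rw [abs_le]
    constructor <;> linarith
  · have hG := norm_integral_comp_floor_div_sub_sum_le
      (fun i => F (i * h) (x i) - h⁻¹ • w i) (A := 2 * M) hh ht.1
      ((norm_sub_le _ _).trans (by linarith [hξM _ hi]))
    simp only [hdiff, Finset.sum_range_sub, hx0] at hG
    convert hG using 2
    abel
  · intro s hs hsM c hc
    rw [hnext, smul_smul]
    refine h4 (s * h⁻¹) (by positivity) ?_ c hc
    rwa [mul_assoc, inv_mul_cancel_left₀ hh.ne']

section Limit

variable {E : Type*} [NormedAddCommGroup E] [NormedSpace ℝ E]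

lemma IsCompact.tendsto_of_forall_dual_tendsto {K : Set E} (hK : IsCompact K) {x : ℕ → E} {y : E}
    (hx : ∀ n, x n ∈ K) (h : ∀ φ : E →L[ℝ] ℝ, Tendsto (fun n => φ (x n)) atTop (𝓝 (φ y))) :
    Tendsto x atTop (𝓝 y) := by
  refine hK.tendsto_nhds_of_unique_mapClusterPt (Eventually.of_forall hx) fun z _ hz => ?_
  by_contra hne
  obtain ⟨φ, hφ⟩ := SeparatingDual.exists_separating_of_ne (R := ℝ) hne
  obtain ⟨k, hk, hkz⟩ := hz.tendsto_subseq
  exact hφ (tendsto_nhds_unique ((φ.continuous.tendsto z).comp hkz)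
    ((h φ).comp hk.tendsto_atTop))

lemma ae_eq_zero_of_forall_dual_setIntegral_eq_zero [CompleteSpace E] {μ : Measure ℝ} {w : ℝ → E}
    (hw : Integrable w μ)
    (h : ∀ (φ : E →L[ℝ] ℝ) (A : Set ℝ), MeasurableSet A → ∫ t in A, φ (w t) ∂μ = 0) :
    w =ᵐ[μ] 0 := by
  refine hw.ae_eq_zero_of_forall_setIntegral_eq_zero fun A hA _ => ?_
  refine SeparatingDual.eq_zero_of_forall_dual_eq_zero (R := ℝ) fun φ => ?_
  rw [← φ.integral_comp_comm hw.integrableOn]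
  exact h φ A hA

variable {μ : Measure ℝ} [IsFiniteMeasure μ]

lemma tendsto_setIntegral_dual_of_weak {x : ℕ → ℝ → E} {y : ℝ → E}
    (h : ∀ g : ℝ → (E →L[ℝ] ℝ), Integrable g μ →
      Tendsto (fun n => ∫ t, g t (x n t) ∂μ) atTop (𝓝 (∫ t, g t (y t) ∂μ)))
    (φ : E →L[ℝ] ℝ) {A : Set ℝ} (hA : MeasurableSet A) :
    Tendsto (fun n => ∫ t in A, φ (x n t) ∂μ) atTop (𝓝 (∫ t in A, φ (y t) ∂μ)) := by
  have h1 := h (A.indicator fun _ => φ) ((integrable_const φ).indicator hA)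
  have h2 : ∀ z : ℝ → E, ∫ t, (A.indicator (fun _ => φ) t) (z t) ∂μ = ∫ t in A, φ (z t) ∂μ :=
    fun z => by
      rw [← integral_indicator hA]
      congr 1
      ext t
      by_cases ht : t ∈ A <;> simp [ht]
  simpa only [h2] using h1

lemma UniformlySmooth.ae_norm_le_norm_sub_add_of_weak (h : UniformlySmooth E) {p : ℝ} (hp : 1 < p)
    {Y V : ℕ → ℝ → E} {y v : ℝ → E} {M Z : ℝ} {c : E}
    (hY : ∀ n, AEStronglyMeasurable (Y n) μ) (hYM : ∀ n, ∀ᵐ t ∂μ, ‖Y n t‖ ≤ M)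
    (hy : AEStronglyMeasurable y μ) (hyM : ∀ᵐ t ∂μ, ‖y t‖ ≤ M)
    (hV : ∀ n, AEStronglyMeasurable (V n) μ) (hVZ : ∀ n, ∀ᵐ t ∂μ, ‖V n t‖ ≤ Z)
    (hvZ : ∀ᵐ t ∂μ, ‖v t‖ ≤ Z)
    (hVv : ∀ᵐ t ∂μ, Tendsto (fun n => V n t) atTop (𝓝 (v t)))
    (hlim : ∀ z : ℝ → E, AEStronglyMeasurable z μ → (∃ M : ℝ, ∀ᵐ t ∂μ, ‖z t‖ ≤ M) →
      ∀ φ : ℝ → ℝ, Integrable φ μ → Tendsto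
        (fun n => ∫ t, (dualMapJ p (z t + Y n t) - dualMapJ p (Y n t)) (Y n t) * φ t ∂μ) atTop
        (𝓝 (∫ t, (dualMapJ p (z t + y t) - dualMapJ p (y t)) (y t) * φ t ∂μ)))
    (hineq : ∀ n, ∀ᵐ t ∂μ, ‖Y n t‖ ≤ ‖V n t - c + Y n t‖) :
    ∀ᵐ t ∂μ, ‖y t‖ ≤ ‖v t - c + y t‖ := by
  have hv : AEStronglyMeasurable v μ := aestronglyMeasurable_of_tendsto_ae atTop hV hVv
  set z : ℝ → E := fun t => v t - c with hz
  have hzm : AEStronglyMeasurable z μ := hv.sub aestronglyMeasurable_const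
  have hzb : ∀ᵐ t ∂μ, ‖z t‖ ≤ Z + ‖c‖ := by
    filter_upwards [hvZ] with t ht
    exact (norm_sub_le _ _).trans (by gcongr)
  have hrem : Tendsto (fun n => -∫ t, p * ((Z + ‖c‖) + M) ^ (p - 1) * ‖v t - V n t‖ ∂μ) atTop
      (𝓝 0) := by
    have h1 : Tendsto (fun n => ∫ t, p * ((Z + ‖c‖) + M) ^ (p - 1) * ‖v t - V n t‖ ∂μ) atTop
        (𝓝 (∫ _, (0 : ℝ) ∂μ)) := by
      refine tendsto_integral_of_dominated_convergence
        (fun _ => |p * ((Z + ‖c‖) + M) ^ (p - 1)| * (Z + Z))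
        (fun n => (hv.sub (hV n)).norm.const_mul _) (integrable_const _) (fun n => ?_) ?_
      · filter_upwards [hvZ, hVZ n] with t h1 h2
        rw [norm_mul, norm_norm, Real.norm_eq_abs]
        gcongr
        exact (norm_sub_le _ _).trans (by gcongr)
      · filter_upwards [hVv] with t ht
        simpa using ((tendsto_const_nhds (x := v t)).sub ht).norm.const_mul
          (p * ((Z + ‖c‖) + M) ^ (p - 1))
    simpa using h1.neg
  have hgap : ∀ A : Set ℝ, MeasurableSet A → 0 ≤ ∫ t in A, (‖z t + y t‖ ^ p - ‖y t‖ ^ p) ∂μ := by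
    intro A hA
    have hψ1 : ∀ t, |A.indicator (1 : ℝ → ℝ) t| ≤ 1 := fun t => by
      by_cases ht : t ∈ A <;> simp [ht]
    have hψm : AEStronglyMeasurable (A.indicator (1 : ℝ → ℝ)) μ :=
      (stronglyMeasurable_one.indicator hA).aestronglyMeasurable
    have hψi : Integrable (A.indicator (1 : ℝ → ℝ)) μ := (integrable_const 1).indicator hA
    have hconv := h.tendsto_rpowGap_one hp hY hYM hy hzm hψm hyM hzb hψ1 fun a =>
      hlim (fun t => a • z t) (hzm.const_smul a) ⟨|a| * (Z + ‖c‖), by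
        filter_upwards [hzb] with t ht
        rw [norm_smul, Real.norm_eq_abs]
        gcongr⟩ _ hψi
    have hlow : ∀ n, -∫ t, p * ((Z + ‖c‖) + M) ^ (p - 1) * ‖v t - V n t‖ ∂μ ≤
        rpowGap μ p (A.indicator 1) (Y n) z 1 := fun n => by
      rw [← integral_neg, rpowGap]
      refine integral_mono_ae (Integrable.neg (Integrable.const_mul ?_ _))
        (integrable_rpow_gap hp.le (hY n) hzm hψm (hYM n) hzb hψ1 (by norm_num)) ?_
      · refine Integrable.of_bound (hv.sub (hV n)).norm (Z + Z) ?_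
        filter_upwards [hvZ, hVZ n] with t h1 h2
        rw [norm_norm]
        exact (norm_sub_le _ _).trans (by gcongr)
      · filter_upwards [hzb, hYM n, hVZ n, hineq n] with t h1 h2 h3 h4
        have hM : 0 ≤ M := (norm_nonneg _).trans h2
        have hZ : 0 ≤ Z := (norm_nonneg _).trans h3
        have h5 := abs_norm_rpow_sub_norm_rpow_le hp.le (R := (Z + ‖c‖) + M)
          (x := z t + Y n t) (y := V n t - c + Y n t) ((norm_add_le _ _).trans (by gcongr))
          ((norm_add_le _ _).trans (add_le_add ((norm_sub_le _ _).trans (by gcongr)) h2))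
        have h6 : z t + Y n t - (V n t - c + Y n t) = v t - V n t := by
          simp only [hz]
          abel
        rw [h6] at h5
        have h7 : ‖Y n t‖ ^ p ≤ ‖V n t - c + Y n t‖ ^ p :=
          Real.rpow_le_rpow (norm_nonneg _) h4 (by linarith)
        have h8 := (abs_le.mp h5).1
        have h9 : 0 ≤ p * ((Z + ‖c‖) + M) ^ (p - 1) * ‖v t - V n t‖ := by positivity
        simp only [one_smul]
        by_cases ht : t ∈ A
        · simp only [ht, indicator_of_mem, Pi.one_apply, mul_one]
          linarith
        · simp only [ht, not_false_eq_true, indicator_of_notMem, mul_zero]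
          linarith
    have hle := le_of_tendsto_of_tendsto' hrem hconv hlow
    rw [← integral_indicator hA]
    refine hle.trans (le_of_eq ?_)
    rw [rpowGap]
    congr 1
    ext t
    by_cases ht : t ∈ A <;> simp [ht]
  have hint : Integrable (fun t => ‖z t + y t‖ ^ p - ‖y t‖ ^ p) μ := by
    simpa using integrable_rpow_gap hp.le hy hzm (aestronglyMeasurable_const (b := (1 : ℝ)))
      hyM hzb (fun _ => by simp) (l := 1) (by norm_num)
  filter_upwards [ae_nonneg_of_forall_setIntegral_nonneg hint fun A hA _ => hgap A hA] with t ht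
  have h1 : ‖y t‖ ^ p ≤ ‖z t + y t‖ ^ p := by simpa using ht
  exact (Real.rpow_le_rpow_iff (norm_nonneg _) (norm_nonneg _) (by linarith)).mp h1

end Limit

lemma mem_proxNormalCone_of_forall_norm_le {E : Type*} [NormedAddCommGroup E] [NormedSpace ℝ E]
    {C : Set E} {x v : E} {s : ℝ} (hs : 0 < s) (hx : x ∈ C)
    (h : ∀ c ∈ C, ‖s • v‖ ≤ ‖x - c + s • v‖) : v ∈ proxNormalCone C x := by
  refine ⟨s, hs, hx, le_antisymm ?_ ?_⟩
  · rw [add_sub_cancel_left, Metric.le_infDist ⟨x, hx⟩]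
    intro c hc
    rw [dist_eq_norm, add_sub_right_comm]
    exact h c hc
  · rw [← dist_eq_norm]
    exact Metric.infDist_le_dist_of_mem hx

/-- Existence for the sweeping process by a fixed set with a time-dependent perturbation. -/
theorem exists_sweeping_fixed_set {E : Type*} [NormedAddCommGroup E] [NormedSpace ℝ E]
    [CompleteSpace E] [TopologicalSpace.SeparableSpace E] (hsmooth : UniformlySmooth E)
    {T p : ℝ} (hp : 1 < p) (hiswc : ISmoothlyWeaklyCompact (Icc 0 T) E p)
    {F : ℝ → E → E} (hFc : Continuous fun q : ℝ × E => F q.1 q.2) {K : ℝ} (hK : 0 ≤ K)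
    (hF : ∀ t ∈ Icc 0 T, ∀ x, ‖F t x‖ ≤ K * (1 + ‖x‖)) {r : ℝ} (hr : 0 < r) {C : Set E}
    (hC : BallCompact C) (hprox : ∀ t ∈ Icc 0 T, DirProxRegular r (F t) C) {u₀ : E}
    (hu₀ : u₀ ∈ C) :
    ∃ g : ℝ → E, IntegrableOn g (Icc 0 T) ∧
      (∀ t ∈ Icc 0 T, u₀ + ∫ s in (0 : ℝ)..t, g s ∈ C) ∧
      ∀ᵐ t ∂volume.restrict (Icc 0 T),
        F t (u₀ + ∫ s in (0 : ℝ)..t, g s) - g t ∈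
          proxNormalCone C (u₀ + ∫ s in (0 : ℝ)..t, g s) := by
  set μ : Measure ℝ := volume.restrict (Icc 0 T) with hμ
  set R : ℝ := Real.exp (2 * K * T) * (1 + ‖u₀‖)
  set M : ℝ := K * R
  have hM0 : 0 ≤ M := by positivity
  set s : ℝ := r / (M + 1) with hs
  have hs0 : 0 < s := by positivity
  have hsM1 : s * (M + 1) = r := div_mul_cancel₀ _ (by positivity)
  have hsM : s * M < r := by linarith
  set η : ℕ → ℝ := fun n => s * (1 / ((n : ℝ) + 1)) with hη
  have hη0 : ∀ n, 0 < η n := fun n => by positivity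
  have hηs : ∀ n, η n ≤ s := fun n => by
    refine mul_le_of_le_one_right hs0.le ?_
    rw [div_le_one (by positivity)]
    linarith [(Nat.cast_nonneg n : (0 : ℝ) ≤ n)]
  have hηlim : Tendsto η atTop (𝓝 0) := by
    simpa [hη] using (tendsto_one_div_add_atTop_nhds_zero_nat (𝕜 := ℝ)).const_mul s
  have hscheme := fun n => exists_catching_up_fun hprox hK hF hu₀ (le_refl M) (hη0 n)
    ((mul_le_mul_of_nonneg_right (hηs n) hM0).trans_lt hsM)
  choose θ X Φ ξ hXm hΦm hξm hall using hscheme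
  have hmemI : ∀ᵐ t ∂μ, t ∈ Icc 0 T := ae_restrict_mem measurableSet_Icc
  have hGb : ∀ n, ∀ t ∈ Icc 0 T, ‖Φ n t - ξ n t‖ ≤ 2 * M := fun n t ht => by
    obtain ⟨-, -, -, -, h1, h2, -⟩ := hall n t ht
    exact (norm_sub_le _ _).trans (by linarith)
  -- a weak limit of the velocities
  obtain ⟨k, hk, g, hgm, ⟨Mg, hgM⟩, hgw, -⟩ := hiswc (fun n t => Φ n t - ξ n t)
    (fun n => ((hΦm n).sub (hξm n)).aestronglyMeasurable)
    ⟨2 * M, fun n => hmemI.mono fun t ht => hGb n t ht⟩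
  have hgi : Integrable g μ := Integrable.of_bound hgm Mg hgM
  set v : ℝ → E := fun t => u₀ + ∫ s in (0 : ℝ)..t, g s with hv
  have hηk : Tendsto (fun n => η (k n)) atTop (𝓝 0) := hηlim.comp hk.tendsto_atTop
  -- strong convergence of the positions
  have hXv : ∀ t ∈ Icc 0 T, Tendsto (fun n => X (k n) t) atTop (𝓝 (v t)) := by
    intro t ht
    refine (hC 0 R).tendsto_of_forall_dual_tendsto (fun n => ?_) fun φ => ?_
    · obtain ⟨-, h1, h2, -⟩ := hall (k n) t ht
      exact ⟨h1, by simpa using h2⟩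
    have hsub : Ioc 0 t ⊆ Icc 0 T := fun q hq => ⟨hq.1.le, hq.2.trans ht.2⟩
    have hres : ∀ x : ℝ → E, Integrable x μ →
        ∫ q in Ioc 0 t, φ (x q) ∂μ = φ (∫ q in (0 : ℝ)..t, x q) := fun x hx => by
      rw [φ.integral_comp_comm hx.integrableOn, intervalIntegral.integral_of_le ht.1, hμ,
        Measure.restrict_restrict measurableSet_Ioc, inter_eq_left.mpr hsub]
    have hGi : ∀ n, Integrable (fun q => Φ n q - ξ n q) μ := fun n =>
      Integrable.of_bound ((hΦm n).sub (hξm n)).aestronglyMeasurable (2 * M)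
        (hmemI.mono fun t ht => hGb n t ht)
    have h1 := tendsto_setIntegral_dual_of_weak (μ := μ) hgw φ (A := Ioc 0 t) measurableSet_Ioc
    simp only [hres _ hgi, hres _ (hGi _)] at h1
    have h2 : Tendsto (fun n => u₀ + (∫ q in (0 : ℝ)..t, (Φ (k n) q - ξ (k n) q)) - X (k n) t)
        atTop (𝓝 0) := by
      refine squeeze_zero_norm (fun n => ?_) (by simpa using hηk.const_mul (2 * M))
      obtain ⟨-, -, -, -, -, -, h3, -⟩ := hall (k n) t ht
      exact h3
    have h3 := (h1.const_add (φ u₀)).sub ((φ.continuous.tendsto 0).comp h2)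
    simp only [Function.comp_def, map_sub, map_add, map_zero, sub_zero] at h3
    simp only [hv, map_add]
    refine h3.congr fun n => ?_
    abel
  have hvK : ∀ t ∈ Icc 0 T, v t ∈ C ∩ Metric.closedBall 0 R := fun t ht => by
    refine (hC 0 R).isClosed.mem_of_tendsto (hXv t ht) (Eventually.of_forall fun n => ?_)
    obtain ⟨-, h1, h2, -⟩ := hall (k n) t ht
    exact ⟨h1, by simpa using h2⟩
  have hvm : AEStronglyMeasurable v μ := aestronglyMeasurable_of_tendsto_ae atTop
    (fun n => (hXm (k n)).aestronglyMeasurable) (hmemI.mono fun t ht => hXv t ht)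
  have hΦv : ∀ t ∈ Icc 0 T, Tendsto (fun n => Φ (k n) t) atTop (𝓝 (F t (v t))) := by
    intro t ht
    have h1 : Tendsto (fun n => θ (k n) t) atTop (𝓝 t) := by
      rw [tendsto_iff_dist_tendsto_zero]
      exact squeeze_zero (fun _ => dist_nonneg) (fun n => (hall (k n) t ht).1) hηk
    refine ((hFc.tendsto (t, v t)).comp (h1.prodMk_nhds (hXv t ht))).congr fun n => ?_
    obtain ⟨-, -, -, h4, -⟩ := hall (k n) t ht
    exact h4.symm
  have hFvm : AEStronglyMeasurable (fun t => F t (v t)) μ :=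
    hFc.comp_aestronglyMeasurable (aestronglyMeasurable_id.prodMk hvm)
  have hΦb : ∀ n, ∀ᵐ t ∂μ, ‖Φ n t‖ ≤ M := fun n => hmemI.mono fun t ht => by
    obtain ⟨-, -, -, -, h1, -⟩ := hall n t ht
    exact h1
  have hFvi : Integrable (fun t => F t (v t)) μ :=
    Integrable.of_bound hFvm M (hmemI.mono fun t ht =>
      le_of_tendsto (hΦv t ht).norm (Eventually.of_forall fun n => by
        obtain ⟨-, -, -, -, h1, -⟩ := hall (k n) t ht
        exact h1))
  -- a weak limit of the normal directions
  have hYb : ∀ n, ∀ᵐ t ∂μ, ‖s • ξ n t‖ ≤ r := fun n => hmemI.mono fun t ht => by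
    obtain ⟨-, -, -, -, -, h1, -⟩ := hall n t ht
    rw [norm_smul, Real.norm_of_nonneg hs0.le]
    exact (mul_le_mul_of_nonneg_left h1 hs0.le).trans hsM.le
  have hYm : ∀ n, AEStronglyMeasurable (fun t => s • ξ n t) μ := fun n =>
    ((hξm n).const_smul s).aestronglyMeasurable
  obtain ⟨j, hj, y, hym, ⟨My, hyM⟩, hyw, hyJ⟩ := hiswc (fun n t => s • ξ (k n) t)
    (fun n => hYm (k n)) ⟨r, fun n => hYb (k n)⟩
  have hyi : Integrable y μ := Integrable.of_bound hym My hyM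
  have hyeq : ∀ᵐ t ∂μ, y t = s • (F t (v t) - g t) := by
    have hwi : Integrable (fun t => s • (F t (v t) - g t)) μ := (hFvi.sub hgi).smul s
    have h0 := ae_eq_zero_of_forall_dual_setIntegral_eq_zero (hyi.sub hwi) fun φ A hA => by
      have h1 := tendsto_setIntegral_dual_of_weak (μ := μ) hyw φ hA
      have h2 := (tendsto_setIntegral_dual_of_weak (μ := μ) hgw φ hA).comp hj.tendsto_atTop
      have h3 : Tendsto (fun n => ∫ t in A, φ (Φ (k (j n)) t) ∂μ) atTop
          (𝓝 (∫ t in A, φ (F t (v t)) ∂μ)) := by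
        refine tendsto_integral_of_dominated_convergence (fun _ => ‖φ‖ * M)
          (fun n => (φ.continuous.comp_stronglyMeasurable (hΦm _)).aestronglyMeasurable)
          (integrable_const _) (fun n => ?_) ?_
        · filter_upwards [ae_restrict_of_ae (hΦb (k (j n)))] with t ht
          exact φ.le_of_opNorm_le_of_le le_rfl ht
        · filter_upwards [ae_restrict_of_ae hmemI] with t ht
          exact ((φ.continuous.tendsto _).comp (hΦv t ht)).comp hj.tendsto_atTop
      have hφi : ∀ x : ℝ → E, Integrable x μ → Integrable (fun t => φ (x t)) (μ.restrict A) :=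
        fun x hx => (φ.integrable_comp hx).integrableOn
      have hΦi : ∀ n, Integrable (Φ n) μ := fun n =>
        Integrable.of_bound (hΦm n).aestronglyMeasurable M (hΦb n)
      have hξi : ∀ n, Integrable (ξ n) μ := fun n =>
        Integrable.of_bound (hξm n).aestronglyMeasurable M (hmemI.mono fun t ht => by
          obtain ⟨-, -, -, -, -, h1, -⟩ := hall n t ht
          exact h1)
      have h4 : ∀ n, ∫ t in A, φ (s • ξ n t) ∂μ =
          s * ((∫ t in A, φ (Φ n t) ∂μ) - ∫ t in A, φ (Φ n t - ξ n t) ∂μ) := fun n => by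
        rw [← integral_sub (hφi _ (hΦi n)) (hφi (fun t => Φ n t - ξ n t)
            ((hΦi n).sub (hξi n))), ← integral_const_mul]
        simp
      have h5 := tendsto_nhds_unique h1
        (((h3.sub h2).const_mul s).congr fun n => (h4 (k (j n))).symm)
      have h6 : ∫ t in A, φ (s • (F t (v t) - g t)) ∂μ =
          s * ((∫ t in A, φ (F t (v t)) ∂μ) - ∫ t in A, φ (g t) ∂μ) := by
        rw [← integral_sub (hφi _ hFvi) (hφi _ hgi), ← integral_const_mul]
        simp
      simp only [Pi.sub_apply, map_sub φ (y _)]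
      rw [integral_sub (hφi _ hyi) (hφi _ hwi), h5, h6, sub_self]
    filter_upwards [h0] with t ht
    exact sub_eq_zero.mp ht
  -- passage to the limit in the normal cone
  have hnormal : ∀ c ∈ C, ∀ᵐ t ∂μ, ‖y t‖ ≤ ‖v t - c + y t‖ := by
    intro c hc
    refine hsmooth.ae_norm_le_norm_sub_add_of_weak hp (M := max r My) (Z := R + s * (2 * M))
      (Y := fun n t => s • ξ (k (j n)) t)
      (V := fun n t => X (k (j n)) t + η (k (j n)) • (Φ (k (j n)) t - ξ (k (j n)) t))
      (fun n => hYm _) (fun n => (hYb _).mono fun t ht => ht.trans (le_max_left _ _)) hym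
      (hyM.mono fun t ht => ht.trans (le_max_right _ _))
      (fun n => ((hXm _).add (((hΦm _).sub (hξm _)).const_smul _)).aestronglyMeasurable)
      (fun n => hmemI.mono fun t ht => ?_) (hmemI.mono fun t ht => ?_)
      (hmemI.mono fun t ht => ?_) hyJ (fun n => hmemI.mono fun t ht => ?_)
    · obtain ⟨-, -, h1, -⟩ := hall (k (j n)) t ht
      refine (norm_add_le _ _).trans (add_le_add h1 ?_)
      rw [norm_smul, Real.norm_of_nonneg (hη0 _).le]
      exact mul_le_mul (hηs _) (hGb _ t ht) (norm_nonneg _) hs0.le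
    · have h1 : ‖v t‖ ≤ R := by simpa using (hvK t ht).2
      have : 0 ≤ s * (2 * M) := by positivity
      linarith
    · have h1 : Tendsto (fun n => η n • (Φ n t - ξ n t)) atTop (𝓝 0) := by
        refine squeeze_zero_norm (fun n => ?_) (by simpa using hηlim.mul_const (2 * M))
        rw [norm_smul, Real.norm_of_nonneg (hη0 _).le]
        exact mul_le_mul_of_nonneg_left (hGb n t ht) (hη0 n).le
      simpa using ((hXv t ht).comp hj.tendsto_atTop).add
        (h1.comp (hk.comp hj).tendsto_atTop)
    · obtain ⟨-, -, -, -, -, -, -, h1⟩ := hall (k (j n)) t ht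
      exact h1 s hs0.le hsM.le c hc
  obtain ⟨D, hDC, hDcount, hDdense⟩ :=
    (TopologicalSpace.IsSeparable.of_separableSpace C).exists_countable_dense_subset
  refine ⟨g, hgi, fun t ht => (hvK t ht).1, ?_⟩
  have hD : ∀ᵐ t ∂μ, ∀ c ∈ D, ‖y t‖ ≤ ‖v t - c + y t‖ :=
    (ae_ball_iff hDcount).mpr fun c hc => hnormal c (hDC hc)
  filter_upwards [hmemI, hyeq, hD] with t ht h1 h2
  refine mem_proxNormalCone_of_forall_norm_le hs0 (hvK t ht).1 fun c hc => ?_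
  have hclosed : IsClosed {c : E | ‖y t‖ ≤ ‖v t - c + y t‖} :=
    isClosed_le continuous_const (by fun_prop)
  have h3 := hclosed.closure_subset_iff.mpr h2 (hDdense hc)
  rwa [mem_ofPred_eq, h1] at h3

lemma proxNormalCone_image_add_const {E : Type*} [NormedAddCommGroup E] [NormedSpace ℝ E]
    {C : Set E} {x v : E} (b : E) (h : v ∈ proxNormalCone C x) :
    v ∈ proxNormalCone ((fun z => z + b) '' C) (x + b) := by
  obtain ⟨s, hs, hx, hd⟩ := h
  refine ⟨s, hs, mem_image_of_mem _ hx, ?_⟩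
  have h1 : Metric.infDist (x + s • v + b) ((fun z => z + b) '' C) =
      Metric.infDist (x + s • v) C :=
    Metric.infDist_image (Φ := fun z => z + b) (isometry_add_right b)
  rw [add_right_comm x b, h1, ← hd, add_sub_add_right_eq_sub]

/-- **Sweeping process in a Banach space with a translating set.** Let `B` be a
separable, reflexive, uniformly smooth Banach space which is `I`-smoothly weakly compact
for an exponent `p ∈ [2,∞)`, `r > 0`, and `f : B → B` continuous with at most linear
growth. Let `a ∈ B` and let `C₀` be a nonempty ball-compact subset of `B` which is
`(r, f(· + t a) - a)`-prox-regular for every `t ∈ I`, and set `C(t) = C₀ + t a`. Then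
for every `u₀ ∈ C₀` the sweeping process `u̇(t) + N(C(t),u(t)) ∋ f(u(t))`, `u(0) = u₀`,
has an absolutely continuous solution `u`, with `u(t) ∈ C(t)` for all `t ∈ I`. -/
theorem sweeping_process_banach_translation
    {B : Type*} [NormedAddCommGroup B] [NormedSpace ℝ B] [CompleteSpace B]
    [TopologicalSpace.SeparableSpace B]
    (hrefl : ReflexiveSpace B) (hsmooth : UniformlySmooth B)
    (T : ℝ) (hT : 0 < T) (p : ℝ) (hp : 2 ≤ p)
    (hiswc : ISmoothlyWeaklyCompact (Set.Icc 0 T) B p)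
    (f : B → B) (hfcont : Continuous f)
    (L : ℝ) (hL : 0 < L) (hfgrowth : ∀ x, ‖f x‖ ≤ L * (1 + ‖x‖))
    (r : ℝ) (hr : 0 < r) (a : B)
    (C₀ : Set B) (hC₀ne : C₀.Nonempty) (hC₀bc : BallCompact C₀)
    (hC₀prox : ∀ t ∈ Set.Icc (0:ℝ) T,
      DirProxRegular r (fun x => f (x + t • a) - a) C₀)
    (u₀ : B) (hu₀ : u₀ ∈ C₀) :
    ∃ u : ℝ → B,
      IsSweepingSol (fun t => (fun x => x + t • a) '' C₀) f T u₀ u := by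
  have hF : ∀ t ∈ Icc 0 T, ∀ x, ‖f (x + t • a) - a‖ ≤ (L * (1 + T * ‖a‖) + ‖a‖) * (1 + ‖x‖) := by
    intro t ht x
    have h1 : ‖x + t • a‖ ≤ ‖x‖ + T * ‖a‖ := by
      refine (norm_add_le _ _).trans ?_
      rw [norm_smul, Real.norm_of_nonneg ht.1]
      gcongr
      exact ht.2
    have h2 := mul_le_mul_of_nonneg_left h1 hL.le
    have h3 : 0 ≤ L * (T * ‖a‖) * ‖x‖ := by positivity
    have h4 : 0 ≤ ‖a‖ * ‖x‖ := by positivity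
    linarith [norm_sub_le (f (x + t • a)) a, hfgrowth (x + t • a)]
  obtain ⟨g, hgi, hgC, hgN⟩ := exists_sweeping_fixed_set hsmooth (by linarith) hiswc
    (F := fun t x => f (x + t • a) - a) (by fun_prop) (by positivity) hF hr hC₀bc hC₀prox hu₀
  refine ⟨fun t => u₀ + (∫ s in (0 : ℝ)..t, g s) + t • a, fun t => g t + a,
    hgi.add (integrable_const a), fun t ht => ?_, fun t ht => mem_image_of_mem _ (hgC t ht), ?_⟩
  · beta_reduce
    have hgt : IntervalIntegrable g volume 0 t := by
      rw [intervalIntegrable_iff_integrableOn_Icc_of_le ht.1]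
      exact hgi.mono_set (Icc_subset_Icc_right ht.2)
    rw [intervalIntegral.integral_add hgt intervalIntegrable_const,
      intervalIntegral.integral_const, sub_zero, add_assoc]
  · filter_upwards [hgN] with t ht
    have h1 := proxNormalCone_image_add_const (t • a) ht
    rwa [sub_sub, add_comm a] at h1
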